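/- Let G be a simple graph on a finite vertex type and let (B, W) be a black-and-white coloring of G. Then there exist supersets B' ⊇ B and W' ⊇ W such that (B', W') is a black-and-white coloring of G that is optimal, i.e., every vertex not in B' ∪ W' has at least one neighbor in B' and at least one neighbor in W'. -/

import Mathlib

/-- Every black-and-white coloring of a finite graph can be extended to an
optimal one: one in which every uncolored vertex has a neighbor in `B'` and a
neighbor in `W'`. -/
theorem bwColoring_exists_optimal_extension {V : Type*} [Fintype V]
    (G : SimpleGraph V) (B W : Set V) (hdisj : Disjoint B W)
    (hBW : ∀ u ∈ B, ∀ v ∈ W, ¬ G.Adj u v) :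
    ∃ B' W' : Set V, B ⊆ B' ∧ W ⊆ W' ∧ Disjoint B' W' ∧
      (∀ u ∈ B', ∀ v ∈ W', ¬ G.Adj u v) ∧
      ∀ v, v ∉ B' ∪ W' → (∃ u ∈ B', G.Adj v u) ∧ (∃ u ∈ W', G.Adj v u) := by
  let B' : Set V := {v | v ∉ W ∧ ∀ w ∈ W, ¬ G.Adj v w}
  let W' : Set V := {v | v ∉ B' ∧ ∀ u ∈ B', ¬ G.Adj u v}
  have hWW' : W ⊆ W' := fun w hw => ⟨fun h => h.1 hw, fun u hu => hu.2 w hw⟩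
  refine ⟨B', W', fun v hv => ⟨hdisj.notMem_of_mem_left hv, hBW v hv⟩, hWW',
    Set.disjoint_left.2 fun v hvB hvW => hvW.1 hvB, fun u hu v hv => hv.2 u hu, ?_⟩
  intro v hv
  have hvB : v ∉ B' := fun h => hv (Or.inl h)
  have hvW : v ∉ W' := fun h => hv (Or.inr h)
  constructor
  · by_contra! h
    exact hvW ⟨hvB, fun u hu huv => h u hu huv.symm⟩
  · by_contra! h
    exact hvB ⟨fun hw => hvW (hWW' hw), fun w hw => h w (hWW' hw)⟩
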